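/- arXiv:2108.04421 — 6 statements merged into one kernel-verified Lean document; each statement's English description precedes it below -/
import Mathlib

section
/- Let D = {z ∈ ℂ : |z| < 1} be the open unit disc and let g : ℂ → ℂ be holomorphic and bounded on D. Let θ_0 ∈ ℝ, δ ∈ (0, π), b = e^{iθ_0}, A_1 = {e^{iθ} : θ_0 − δ < θ < θ_0}, and A_2 = {e^{iθ} : θ_0 < θ < θ_0 + δ}. Suppose there exist a continuous function u : D ∪ A_1 → ℝ with u(z) = Re g(z) for z ∈ D and u constant on A_1, and a continuous function v : D ∪ A_2 → ℝ with v(z) = Im g(z) for z ∈ D and v constant on A_2. Then g has a limit at b within D: there exists L ∈ ℂ such that g(z) → L as z → b with z ∈ D. -/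
open Filter Topology Complex

/-- Maximum modulus principle for a bounded open set, assuming only that the upper limits of
`‖G‖` at the frontier are at most `C`. -/
theorem norm_le_of_forall_frontier_eventually_le {U : Set ℂ} (hU : IsOpen U)
    (hb : Bornology.IsBounded U) {G : ℂ → ℂ} (hG : DifferentiableOn ℂ G U) {C : ℝ}
    (hfr : ∀ ξ ∈ frontier U, ∀ η > 0, ∀ᶠ z in 𝓝[U] ξ, ‖G z‖ ≤ C + η) :
    ∀ z ∈ U, ‖G z‖ ≤ C := by
  intro z hz
  refine le_of_forall_pos_le_add fun η hη => ?_
  set V : Set ℂ := U ∩ {w | C + η < ‖G w‖} with hV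
  have hVo : IsOpen V := hG.continuousOn.norm.isOpen_inter_preimage hU isOpen_Ioi
  have hVU : closure V ⊆ U := by
    intro ξ hξ
    by_contra hξU
    have hξf : ξ ∈ frontier U :=
      ⟨closure_mono Set.inter_subset_left hξ, fun h => hξU (interior_subset h)⟩
    have h1 := hfr ξ hξf η hη
    have h2 : ∃ᶠ w in 𝓝 ξ, w ∈ V := mem_closure_iff_frequently.1 hξ
    rw [eventually_nhdsWithin_iff] at h1
    obtain ⟨w, hw, hw'⟩ := (h2.and_eventually h1).exists
    exact absurd (hw' hw.1) (not_le.2 hw.2)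
  by_contra hlt
  have hzV : z ∈ V := ⟨hz, not_le.1 hlt⟩
  refine hlt (Complex.norm_le_of_forall_mem_frontier_norm_le (U := V)
    (hb.subset Set.inter_subset_left) ⟨hG.mono Set.inter_subset_left, hG.continuousOn.mono hVU⟩
    (fun w hw => ?_) (subset_closure hzV))
  by_contra hw'
  rw [hVo.frontier_eq] at hw
  exact hw.2 ⟨hVU hw.1, not_le.1 hw'⟩

/-- A function holomorphic in the upper half plane whose imaginary part is bounded above and has
boundary values zero near `0`, except possibly at `0`, satisfies a linear bound near `0`. -/
theorem im_le_mul_im_of_tendsto_zero {F : ℂ → ℂ} (hF : DifferentiableOn ℂ F {z | 0 < z.im})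
    {M : ℝ} (hM : 0 < M) (hFM : ∀ z : ℂ, 0 < z.im → (F z).im ≤ M) {a : ℝ} (ha : 0 < a)
    (ha' : 4 * a ≤ 1)
    (hlim : ∀ t : ℝ, |t| ≤ 2 * a → t ≠ 0 →
      Tendsto (fun z => (F z).im) (𝓝[{z | 0 < z.im}] (t : ℂ)) (𝓝 0))
    {z : ℂ} (hx : |z.re| ≤ a) (hy : 0 < z.im) (hy' : z.im < a / 2) :
    (F z).im ≤ 4 * M / a * z.im := by
  set x := z.re with hxdef
  set K : ℝ := 4 * M / a ^ 2 with hK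
  have hKpos : 0 < K := by positivity
  have hKa : K * (a ^ 2 / 4) = M := by rw [hK]; field_simp
  set U : Set ℂ := Set.Ioo (x - a) (x + a) ×ℂ Set.Ioo 0 (a / 2) with hUdef
  have hU : IsOpen U := isOpen_Ioo.reProdIm isOpen_Ioo
  have hbU : Bornology.IsBounded U := (Metric.isBounded_Ioo _ _).reProdIm (Metric.isBounded_Ioo _ _)
  have hcl : ∀ w ∈ closure U, (x - a ≤ w.re ∧ w.re ≤ x + a) ∧ 0 ≤ w.im ∧ w.im ≤ a / 2 := by
    intro w hw
    rw [hUdef, Complex.closure_reProdIm, closure_Ioo (by linarith), closure_Ioo (by linarith)] at hw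
    exact hw
  have hnorm : ∀ w ∈ closure U, ‖w‖ ≤ 1 := by
    intro w hw
    obtain ⟨⟨h1, h2⟩, h3, h4⟩ := hcl w hw
    have h5 := abs_le.1 hx
    have : |w.re| ≤ 2 * a := abs_le.2 ⟨by linarith, by linarith⟩
    have h6 : |w.im| ≤ a / 2 := abs_le.2 ⟨by linarith, by linarith⟩
    linarith [Complex.norm_le_abs_re_add_abs_im w]
  have hbar : ∀ w ∈ closure U, 0 ≤ (w.re - x) ^ 2 - w.im ^ 2 + a * w.im := by
    intro w hw
    obtain ⟨-, h3, h4⟩ := hcl w hw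
    nlinarith [sq_nonneg (w.re - x), mul_nonneg h3 (show 0 ≤ a - w.im by linarith)]
  have key : ∀ ε > 0, (F z).im - K * (a * z.im) + ε * Real.log ‖z‖ ≤ 0 := by
    intro ε hε
    set φ : ℂ → ℂ := fun w =>
      -I * F w - K * ((w - x) ^ 2 - I * a * (w - x)) + ε * Complex.log w with hφ
    have hre : ∀ w, (φ w).re =
        (F w).im - K * ((w.re - x) ^ 2 - w.im ^ 2 + a * w.im) + ε * Real.log ‖w‖ := by
      intro w
      simp [hφ, pow_two, Complex.log_re]
    have hφd : ∀ w : ℂ, 0 < w.im → DifferentiableAt ℂ φ w := by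
      intro w hw
      have h1 : DifferentiableAt ℂ F w :=
        hF.differentiableAt ((isOpen_lt continuous_const continuous_im).mem_nhds hw)
      have h2 : w ∈ slitPlane := Or.inr hw.ne'
      have h3 := Complex.differentiableAt_log h2
      fun_prop
    have hle : ∀ w ∈ U, (φ w).re ≤ (F w).im := by
      intro w hw
      have hw' := subset_closure hw
      rw [hre]
      have := mul_nonneg hKpos.le (hbar w hw')
      have := mul_nonpos_of_nonneg_of_nonpos hε.le
        (Real.log_nonpos (norm_nonneg w) (hnorm w hw'))
      linarith
    have hmain := norm_le_of_forall_frontier_eventually_le hU hbU (G := fun w => exp (φ w)) (C := 1)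
      (fun w hw => ((hφd w hw.2.1).cexp).differentiableWithinAt) ?_ z
      ⟨⟨by linarith, by linarith⟩, hy, hy'⟩
    · rw [Complex.norm_exp, Real.exp_le_one_iff, hre] at hmain
      nlinarith [mul_pos hKpos (pow_pos hy 2)]
    intro ξ hξ η hη
    have hξc := frontier_subset_closure hξ
    obtain ⟨⟨h1, h2⟩, h3, h4⟩ := hcl ξ hξc
    have hξU : ξ ∉ U := by
      rw [hU.frontier_eq] at hξ; exact hξ.2
    simp only [Complex.norm_exp]
    rcases h3.eq_or_lt with him | him
    · have hUim : U ⊆ {w | 0 < w.im} := fun w hw => hw.2.1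
      by_cases hξ0 : ξ.re = 0
      · have hξ0' : ξ = 0 := Complex.ext hξ0 him.symm
        have hl : Tendsto (fun w : ℂ => M + ε * Real.log ‖w‖) (𝓝[≠] 0) atBot := by
          refine tendsto_atBot_add_const_left _ _ (Tendsto.const_mul_atBot hε ?_)
          exact Real.tendsto_log_nhdsGT_zero.comp tendsto_norm_nhdsNE_zero
        have hl' : ∀ᶠ w in 𝓝[U] ξ, M + ε * Real.log ‖w‖ ≤ 0 := by
          rw [hξ0']
          refine (hl.mono_left (nhdsWithin_mono _ fun w hw => ?_)).eventually_le_atBot 0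
          rintro rfl
          exact lt_irrefl _ hw.2.1
        filter_upwards [hl', self_mem_nhdsWithin] with w hw hwU
        have h5 : (φ w).re ≤ 0 := by
          rw [hre]
          have := mul_nonneg hKpos.le (hbar w (subset_closure hwU))
          have := hFM w hwU.2.1
          linarith
        linarith [Real.exp_le_one_iff.2 h5]
      · have hξr : ξ = (ξ.re : ℂ) := Complex.ext rfl him.symm
        have h5 := abs_le.1 hx
        have hl := hlim ξ.re (abs_le.2 ⟨by linarith, by linarith⟩) hξ0
        rw [← hξr] at hl
        have hl2 := (Real.continuous_exp.tendsto 0).comp (hl.mono_left (nhdsWithin_mono _ hUim))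
        rw [Real.exp_zero] at hl2
        filter_upwards [hl2.eventually_le_const (show (1 : ℝ) < 1 + η by linarith),
          self_mem_nhdsWithin] with w hw hwU
        exact (Real.exp_le_exp.2 (hle w hwU)).trans hw
    · have hc : ContinuousAt (fun w => Real.exp (φ w).re) ξ :=
        Real.continuous_exp.continuousAt.comp
          (continuous_re.continuousAt.comp (hφd ξ him).continuousAt)
      have h5 : (φ ξ).re ≤ 0 := by
        rw [hre]
        have h6 := hFM ξ him
        have h7 := mul_nonpos_of_nonneg_of_nonpos hε.le
          (Real.log_nonpos (norm_nonneg ξ) (hnorm ξ hξc))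
        have h8 : a ^ 2 / 4 ≤ (ξ.re - x) ^ 2 - ξ.im ^ 2 + a * ξ.im := by
          by_cases h9 : ξ.im = a / 2
          · rw [h9]; nlinarith [sq_nonneg (ξ.re - x)]
          · have h10 : ξ.im < a / 2 := lt_of_le_of_ne h4 h9
            have h11 : (ξ.re - x) ^ 2 = a ^ 2 := by
              by_contra hne
              refine hξU ⟨⟨lt_of_le_of_ne h1 fun h => hne ?_, lt_of_le_of_ne h2 fun h => hne ?_⟩,
                him, h10⟩
              · rw [← h]; ring
              · rw [h]; ring
            nlinarith [mul_nonneg h3 (show 0 ≤ a - ξ.im by linarith)]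
        have := mul_le_mul_of_nonneg_left h8 hKpos.le
        linarith
      have h6 : Real.exp (φ ξ).re < 1 + η := by linarith [Real.exp_le_one_iff.2 h5]
      exact nhdsWithin_le_nhds ((hc.eventually_lt continuousAt_const h6).mono fun w hw => hw.le)
  have hlimε : Tendsto (fun ε : ℝ => (F z).im - K * (a * z.im) + ε * Real.log ‖z‖) (𝓝[>] 0)
      (𝓝 ((F z).im - K * (a * z.im) + 0 * Real.log ‖z‖)) :=
    (Continuous.tendsto (by fun_prop) 0).mono_left nhdsWithin_le_nhds
  have h := le_of_tendsto hlimε (eventually_mem_nhdsWithin.mono fun ε hε => key ε hε)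
  have hKa' : K * (a * z.im) = 4 * M / a * z.im := by rw [hK]; field_simp
  linarith

/-- If `F` is holomorphic with `|Im F| ≤ K` on a closed disc of radius `R`, then the derivative of
`F` at the center has norm at most `K e² / R`. -/
theorem norm_deriv_le_of_abs_im_le {F : ℂ → ℂ} {c : ℂ} {R K : ℝ} (hR : 0 < R) (hK : 0 < K)
    (hF : ∀ w ∈ Metric.closedBall c R, DifferentiableAt ℂ F w)
    (hb : ∀ w ∈ Metric.closedBall c R, |(F w).im| ≤ K) :
    ‖deriv F c‖ ≤ K * Real.exp 2 / R := by
  have hc : c ∈ Metric.closedBall c R := Metric.mem_closedBall_self hR.le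
  set E : ℂ → ℂ := fun w => exp (-I * F w / K) with hE
  have hEd : ∀ w ∈ Metric.closedBall c R, DifferentiableAt ℂ E w := fun w hw =>
    (((hF w hw).const_mul _).div_const _).cexp
  have hEn : ∀ w, ‖E w‖ = Real.exp ((F w).im / K) := by
    intro w
    simp [hE, Complex.norm_exp]
  have hEc : ‖deriv E c‖ ≤ Real.exp 1 / R := by
    refine Complex.norm_deriv_le_of_forall_mem_sphere_norm_le hR ?_ fun w hw => ?_
    · refine DifferentiableOn.diffContOnCl (fun w hw => ?_)
      exact (hEd w (Metric.closure_ball_subset_closedBall hw)).differentiableWithinAt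
    · rw [hEn, Real.exp_le_exp, div_le_one hK]
      exact (abs_le.1 (hb w (Metric.sphere_subset_closedBall hw))).2
  have hder : deriv E c = E c * (-I * deriv F c / K) :=
    ((((hF c hc).hasDerivAt.const_mul _).div_const _).cexp).deriv
  have hlow : Real.exp (-1) ≤ ‖E c‖ := by
    rw [hEn, Real.exp_le_exp, le_div_iff₀ hK]
    linarith [(abs_le.1 (hb c hc)).1]
  have hn : ‖deriv E c‖ = ‖E c‖ * (‖deriv F c‖ / K) := by
    rw [hder]
    simp [abs_of_pos hK]
  have h1 : Real.exp (-1) * (‖deriv F c‖ / K) ≤ Real.exp 1 / R :=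
    (mul_le_mul_of_nonneg_right hlow (by positivity)).trans (hn ▸ hEc)
  have h2 : ‖deriv F c‖ / K ≤ Real.exp 2 / R := by
    have h3 := mul_le_mul_of_nonneg_left h1 (Real.exp_pos 1).le
    rwa [← mul_assoc, ← Real.exp_add, ← mul_div_assoc (Real.exp 1) (Real.exp 1) R, ← Real.exp_add,
      add_neg_cancel, one_add_one_eq_two, Real.exp_zero, one_mul] at h3
  rw [div_le_iff₀ hK] at h2
  calc ‖deriv F c‖ ≤ Real.exp 2 / R * K := h2
    _ = K * Real.exp 2 / R := by ring

/-- A function holomorphic in the upper half plane whose imaginary part is bounded and has boundary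
values zero at all nonzero real points near `0` has a limit at `0`. -/
theorem exists_tendsto_of_tendsto_im_zero {F : ℂ → ℂ}
    (hF : DifferentiableOn ℂ F {z | 0 < z.im}) {M : ℝ}
    (hFM : ∀ z : ℂ, 0 < z.im → |(F z).im| ≤ M) {δ : ℝ} (hδ : 0 < δ)
    (hlim : ∀ t : ℝ, |t| < δ → t ≠ 0 →
      Tendsto (fun z => (F z).im) (𝓝[{z | 0 < z.im}] (t : ℂ)) (𝓝 0)) :
    ∃ L : ℂ, Tendsto F (𝓝[{z | 0 < z.im}] 0) (𝓝 L) := by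
  wlog hM : 0 < M generalizing M
  · exact this (M := 1) (fun z hz => (hFM z hz).trans (by linarith)) one_pos
  have hHo : IsOpen {z : ℂ | 0 < z.im} := isOpen_lt continuous_const continuous_im
  obtain ⟨a, ha, ha1, ha2⟩ : ∃ a : ℝ, 0 < a ∧ 4 * a ≤ 1 ∧ 2 * a < δ :=
    ⟨min (1 / 4) (δ / 4), by positivity, by linarith [min_le_left (1 / 4) (δ / 4)],
      by linarith [min_le_right (1 / 4) (δ / 4)]⟩
  have him : ∀ z : ℂ, |z.re| ≤ a → 0 < z.im → z.im < a / 2 →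
      |(F z).im| ≤ 4 * M / a * z.im := by
    intro z hx hy hy'
    rw [abs_le']
    refine ⟨im_le_mul_im_of_tendsto_zero hF hM (fun w hw => (le_abs_self _).trans (hFM w hw)) ha
      ha1 (fun t ht => hlim t (ht.trans_lt ha2)) hx hy hy', ?_⟩
    have := im_le_mul_im_of_tendsto_zero hF.neg hM (fun w hw => ?_) ha
      ha1 (fun t ht ht0 => ?_) hx hy hy'
    · simpa using this
    · simpa using (neg_le_abs _).trans (hFM w hw)
    · simpa using (hlim t (ht.trans_lt ha2) ht0).neg
  set S : Set ℂ := Metric.ball 0 (a / 4) ∩ {z | 0 < z.im} with hS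
  have hSc : Convex ℝ S := (convex_ball _ _).inter (convex_halfSpace_im_gt 0)
  have hder : ∀ z ∈ S, ‖deriv F z‖ ≤ 12 * M / a * Real.exp 2 := by
    rintro z ⟨hz, hz0⟩
    rw [mem_ball_zero_iff] at hz
    have hz0 : 0 < z.im := hz0
    have hball : ∀ w ∈ Metric.closedBall z (z.im / 2),
        |w.re| ≤ a ∧ 0 < w.im ∧ w.im < a / 2 ∧ w.im ≤ 3 / 2 * z.im := by
      intro w hw
      rw [mem_closedBall_iff_norm] at hw
      have h1 := (Complex.abs_re_le_norm (w - z)).trans hw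
      have h2 := (Complex.abs_im_le_norm (w - z)).trans hw
      have h3 := (Complex.abs_re_le_norm z).trans hz.le
      have h4 := (Complex.abs_im_le_norm z).trans hz.le
      rw [sub_re, abs_le] at h1
      rw [sub_im, abs_le] at h2
      rw [abs_le] at h3 h4
      refine ⟨abs_le.2 ⟨?_, ?_⟩, ?_, ?_, ?_⟩ <;> linarith [h1.1, h1.2, h2.1, h2.2, h3.1, h3.2, h4.2]
    have := norm_deriv_le_of_abs_im_le (F := F) (c := z) (R := z.im / 2)
      (K := 4 * M / a * (3 / 2 * z.im)) (by positivity) (by positivity)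
      (fun w hw => hF.differentiableAt (hHo.mem_nhds (hball w hw).2.1)) (fun w hw => ?_)
    · refine this.trans_eq ?_
      field_simp
      ring
    · obtain ⟨h1, h2, h3, h4⟩ := hball w hw
      exact (him w h1 h2 h3).trans (mul_le_mul_of_nonneg_left h4 (by positivity))
  have hlip : LipschitzOnWith (12 * M / a * Real.exp 2).toNNReal F S := by
    refine hSc.lipschitzOnWith_of_nnnorm_deriv_le
      (fun z hz => hF.differentiableAt (hHo.mem_nhds hz.2)) fun z hz => ?_
    exact NNReal.le_toNNReal_of_coe_le (hder z hz)
  obtain ⟨G, hG, hFG⟩ := hlip.extend_finite_dimension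
  refine ⟨G 0, ?_⟩
  rw [← nhdsWithin_inter_of_mem' (nhdsWithin_le_nhds
    (Metric.ball_mem_nhds (0 : ℂ) (show 0 < a / 4 by positivity))), Set.inter_comm]
  exact ((hG.continuous.tendsto 0).mono_left nhdsWithin_le_nhds).congr'
    (eventually_mem_nhdsWithin.mono fun z hz => (hFG hz).symm)

/-- A continuous square root of a function with a limit at a boundary point of a convex set has
a limit there. -/
theorem Convex.exists_tendsto_of_tendsto_sq {S : Set ℂ} (hS : Convex ℝ S) {h : ℂ → ℂ}
    (hh : ContinuousOn h S) {p w : ℂ} (hw : Tendsto (fun z => h z ^ 2) (𝓝[S] p) (𝓝 w)) :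
    ∃ L : ℂ, Tendsto h (𝓝[S] p) (𝓝 L) := by
  obtain ⟨s, rfl⟩ : ∃ s : ℂ, s ^ 2 = w := IsAlgClosed.exists_pow_nat_eq w two_pos
  by_cases hs : s = 0
  · refine ⟨0, ?_⟩
    rw [tendsto_zero_iff_norm_tendsto_zero]
    have h1 := (Real.continuous_sqrt.tendsto _).comp hw.norm
    simpa [hs, Function.comp_def, Real.sqrt_sq] using h1
  have hq : Tendsto (fun z => (h z / s) ^ 2) (𝓝[S] p) (𝓝 1) := by
    have := hw.div_const (s ^ 2)
    rw [div_self (pow_ne_zero 2 hs)] at this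
    simpa [div_pow] using this
  have hre : ∀ᶠ z in 𝓝[S] p, 0 < ((h z / s) ^ 2).re :=
    ((continuous_re.tendsto 1).comp hq).eventually_const_lt (by simp)
  obtain ⟨r, hr, hr'⟩ := Metric.mem_nhdsWithin_iff.1 hre
  set T : Set ℂ := Metric.ball p r ∩ S with hT
  have hTS : 𝓝[S] p = 𝓝[T] p := by
    rw [hT, Set.inter_comm,
      nhdsWithin_inter_of_mem' (nhdsWithin_le_nhds (Metric.ball_mem_nhds p hr))]
  have hTc : IsPreconnected T := ((convex_ball p r).inter hS).isPreconnected
  have hcont : ContinuousOn (fun z => (h z / s).re) T :=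
    continuous_re.comp_continuousOn ((hh.mono Set.inter_subset_right).div_const s)
  have hne : ∀ z ∈ T, (h z / s).re ≠ 0 := by
    intro z hz h0
    have h1 : 0 < ((h z / s) ^ 2).re := hr' hz
    rw [pow_two, mul_re, h0] at h1
    nlinarith [mul_self_nonneg (h z / s).im]
  have hcase : ∃ σ : ℂ, σ ^ 2 = 1 ∧ ∀ z ∈ T, 0 < (σ * (h z / s)).re := by
    by_cases hpos : ∀ z ∈ T, 0 < (h z / s).re
    · exact ⟨1, by norm_num, by simpa using hpos⟩
    · push Not at hpos
      obtain ⟨z, hz, hz0⟩ := hpos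
      refine ⟨-1, by norm_num, fun y hy => ?_⟩
      by_contra hy0
      have hy0' : 0 ≤ (h y / s).re := by simpa using hy0
      obtain ⟨x, hx, hx0⟩ := hTc.intermediate_value hz hy hcont ⟨hz0, hy0'⟩
      exact hne x hx hx0
  obtain ⟨σ, hσ, hpos⟩ := hcase
  have hone : Tendsto (fun z => σ * (h z / s)) (𝓝[T] p) (𝓝 1) := by
    rw [tendsto_iff_norm_sub_tendsto_zero]
    have h1 := tendsto_iff_norm_sub_tendsto_zero.1 (hTS ▸ hq)
    refine squeeze_zero' (Eventually.of_forall fun _ => norm_nonneg _)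
      (eventually_mem_nhdsWithin.mono fun z hz => ?_) h1
    set k := σ * (h z / s) with hk
    have h2 : (h z / s) ^ 2 - 1 = (k - 1) * (k + 1) := by
      have : k ^ 2 = (h z / s) ^ 2 := by rw [hk, mul_pow, hσ, one_mul]
      rw [← this]; ring
    have h3 : 1 ≤ ‖k + 1‖ := by
      have h4 : 0 < k.re := hpos z hz
      have h5 := Complex.re_le_norm (k + 1)
      rw [add_re, one_re] at h5
      linarith
    rw [h2, norm_mul]
    exact le_mul_of_one_le_right (norm_nonneg _) h3
  refine ⟨σ * s, ?_⟩
  rw [hTS]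
  have h6 := hone.const_mul (σ * s)
  rw [mul_one] at h6
  refine h6.congr fun z => ?_
  have : σ * s * (σ * (h z / s)) = σ ^ 2 * h z := by field_simp
  rw [this, hσ, one_mul]


/-- **Continuity at a boundary point between two arcs (Lemma 4.19(2)).** If `g` is a bounded
holomorphic function on the unit disc whose real part is continuous up to, and constant on, an
arc `A₁` ending at `b = e^{iθ₀}`, and whose imaginary part is continuous up to, and constant on,
an arc `A₂` starting at `b`, then `g` has a limit at `b` within the disc. -/
theorem holomorphic_limit_at_corner
    (g : ℂ → ℂ) (hg : DifferentiableOn ℂ g (Metric.ball 0 1))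
    (hbdd : ∃ M : ℝ, ∀ z ∈ Metric.ball (0 : ℂ) 1, ‖g z‖ ≤ M)
    (θ₀ δ : ℝ) (hδ : 0 < δ) (hδπ : δ < Real.pi)
    (A₁ A₂ : Set ℂ)
    (hA₁ : A₁ = (fun θ : ℝ => Complex.exp (θ * Complex.I)) '' Set.Ioo (θ₀ - δ) θ₀)
    (hA₂ : A₂ = (fun θ : ℝ => Complex.exp (θ * Complex.I)) '' Set.Ioo θ₀ (θ₀ + δ))
    (u : ℂ → ℝ) (hu : ContinuousOn u (Metric.ball 0 1 ∪ A₁))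
    (huRe : ∀ z ∈ Metric.ball (0 : ℂ) 1, u z = (g z).re)
    (huconst : ∃ c : ℝ, ∀ z ∈ A₁, u z = c)
    (v : ℂ → ℝ) (hv : ContinuousOn v (Metric.ball 0 1 ∪ A₂))
    (hvIm : ∀ z ∈ Metric.ball (0 : ℂ) 1, v z = (g z).im)
    (hvconst : ∃ c : ℝ, ∀ z ∈ A₂, v z = c) :
    ∃ L : ℂ, Filter.Tendsto g
      (nhdsWithin (Complex.exp (θ₀ * Complex.I)) (Metric.ball 0 1)) (nhds L) := by
  obtain ⟨M, hM⟩ := hbdd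
  obtain ⟨c₁, hc₁⟩ := huconst
  obtain ⟨c₂, hc₂⟩ := hvconst
  set c : ℂ := ⟨c₁, c₂⟩ with hc
  set e : ℂ → ℂ := fun ζ => exp ((θ₀ + ζ) * I) with he
  have hed : Differentiable ℂ e := by fun_prop
  have hmaps : ∀ ζ : ℂ, 0 < ζ.im → e ζ ∈ Metric.ball (0 : ℂ) 1 := by
    intro ζ hζ
    rw [mem_ball_zero_iff, he, Complex.norm_exp, Real.exp_lt_one_iff]
    simpa using hζ
  have hbound : ∀ {f : ℂ → ℝ} {A : Set ℂ} {d : ℝ}, ContinuousOn f (Metric.ball 0 1 ∪ A) →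
      (∀ z ∈ A, f z = d) → ∀ t : ℝ, e t ∈ A →
      Tendsto (fun ζ => f (e ζ) - d) (𝓝[{z | 0 < z.im}] (t : ℂ)) (𝓝 0) := by
    intro f A d hf hA t ht
    have h1 : Tendsto e (𝓝[{z | 0 < z.im}] (t : ℂ)) (𝓝[Metric.ball 0 1 ∪ A] (e t)) :=
      tendsto_nhdsWithin_iff.2 ⟨hed.continuous.continuousAt.mono_left nhdsWithin_le_nhds,
        eventually_mem_nhdsWithin.mono fun ζ hζ => Or.inl (hmaps ζ hζ)⟩
    have h2 := ((hf (e t) (Or.inr ht)).tendsto.comp h1).sub_const d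
    rwa [hA _ ht, sub_self] at h2
  set h : ℂ → ℂ := fun ζ => g (e ζ) - c with hh
  have hhd : DifferentiableOn ℂ h {z | 0 < z.im} :=
    (hg.comp hed.differentiableOn hmaps).sub_const c
  have hhM : ∀ ζ : ℂ, 0 < ζ.im → ‖h ζ‖ ≤ M + ‖c‖ := fun ζ hζ =>
    (norm_sub_le _ _).trans (by linarith [hM _ (hmaps ζ hζ)])
  have hsq : ∀ ζ : ℂ, (h ζ ^ 2).im = 2 * (h ζ).re * (h ζ).im := by
    intro ζ
    rw [pow_two, mul_im]
    ring
  have hlim : ∀ t : ℝ, |t| < δ → t ≠ 0 →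
      Tendsto (fun ζ => (h ζ ^ 2).im) (𝓝[{z | 0 < z.im}] (t : ℂ)) (𝓝 0) := by
    intro t ht ht0
    rw [abs_lt] at ht
    simp only [hsq]
    rcases lt_or_gt_of_ne ht0 with htn | htp
    · have h1 : Tendsto (fun ζ => 2 * (h ζ).re) (𝓝[{z | 0 < z.im}] (t : ℂ)) (𝓝 0) := by
        have h2 := (hbound hu hc₁ t
          (hA₁ ▸ ⟨θ₀ + t, ⟨by linarith, by linarith⟩, by simp [he]⟩)).const_mul 2
        rw [mul_zero] at h2
        refine h2.congr' (eventually_mem_nhdsWithin.mono fun ζ hζ => ?_)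
        simp [huRe _ (hmaps ζ hζ), hh, hc]
      refine h1.zero_mul_isBoundedUnder_le ⟨M + ‖c‖, eventually_map.2 ?_⟩
      exact eventually_mem_nhdsWithin.mono fun ζ hζ => (abs_im_le_norm _).trans (hhM ζ hζ)
    · have h1 : Tendsto (fun ζ => (h ζ).im) (𝓝[{z | 0 < z.im}] (t : ℂ)) (𝓝 0) := by
        refine (hbound hv hc₂ t
          (hA₂ ▸ ⟨θ₀ + t, ⟨by linarith, by linarith⟩, by simp [he]⟩)).congr'
          (eventually_mem_nhdsWithin.mono fun ζ hζ => ?_)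
        simp [hvIm _ (hmaps ζ hζ), hh, hc]
      refine isBoundedUnder_le_mul_tendsto_zero ⟨2 * (M + ‖c‖), eventually_map.2 ?_⟩ h1
      refine eventually_mem_nhdsWithin.mono fun ζ hζ => ?_
      have h2 := (abs_re_le_norm _).trans (hhM ζ hζ)
      simpa [abs_mul] using h2
  obtain ⟨w, hw⟩ := exists_tendsto_of_tendsto_im_zero (F := fun ζ => h ζ ^ 2) (hhd.pow 2)
    (M := (M + ‖c‖) ^ 2) (fun ζ hζ => (abs_im_le_norm _).trans (by
      rw [norm_pow]
      exact pow_le_pow_left₀ (norm_nonneg _) (hhM ζ hζ) 2)) hδ hlim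
  obtain ⟨L, hL⟩ := (convex_halfSpace_im_gt 0).exists_tendsto_of_tendsto_sq hhd.continuousOn hw
  refine ⟨L + c, ?_⟩
  set b : ℂ := exp (θ₀ * I) with hb
  have hb0 : b ≠ 0 := exp_ne_zero _
  have hbn : ‖b‖ = 1 := norm_exp_ofReal_mul_I θ₀
  set ℓ : ℂ → ℂ := fun z => -I * Complex.log (z / b) with hℓ
  have hinv : ∀ z, z ≠ 0 → e (ℓ z) = z := by
    intro z hz
    have h1 : (θ₀ + ℓ z) * I = θ₀ * I + Complex.log (z / b) := by
      linear_combination (-Complex.log (z / b)) * I_sq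
    simp only [he]
    rw [h1, exp_add, exp_log (div_ne_zero hz hb0), ← hb, mul_div_cancel₀ _ hb0]
  have hne : ∀ᶠ z in 𝓝[Metric.ball 0 1] b, z ≠ 0 :=
    nhdsWithin_le_nhds (isOpen_ne.mem_nhds hb0)
  have hℓt : Tendsto ℓ (𝓝[Metric.ball 0 1] b) (𝓝[{z | 0 < z.im}] 0) := by
    refine tendsto_nhdsWithin_iff.2 ⟨?_, ?_⟩
    · have h1 : ContinuousAt ℓ b := by
        refine continuousAt_const.mul ((continuousAt_id.div_const b).clog ?_)
        simp [hb0]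
      have h2 : ℓ b = 0 := by simp [hℓ, hb0]
      exact h2 ▸ h1.mono_left nhdsWithin_le_nhds
    · filter_upwards [hne, self_mem_nhdsWithin] with z hz hzb
      rw [mem_ball_zero_iff] at hzb
      have : Real.log ‖z‖ < 0 := Real.log_neg (norm_pos_iff.2 hz) hzb
      simpa [hℓ, Complex.log_re, hbn] using this
  refine ((hL.comp hℓt).add_const c).congr' (hne.mono fun z hz => ?_)
  simp [hh, hinv z hz]
end

section
/- Let N ≥ 1 and let x_1 < x_2 < ⋯ < x_{2N} be real numbers. Define the N×N real matrix P by P_{r,s} = ∫_{x_{2r−1}}^{x_{2r}} u^{s−1} · ∏_{j=1}^{2N} |u − x_j|^{−1/2} du for r, s ∈ {1,…,N} (each entry is a finite, absolutely convergent integral). Then det P > 0; in particular, P is invertible. -/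
open MeasureTheory

/-- A form of **Andréief's identity**: the determinant of a matrix of integrals,
with one measure for each row, is the integral of the determinant over the product measure. -/
theorem det_integral_eq_integral_det {n : Type*} [Fintype n] [DecidableEq n] {α : Type*}
    [MeasurableSpace α] (μ : n → Measure α) [∀ r, SigmaFinite (μ r)] (f : n → α → ℝ)
    (hf : ∀ r s, Integrable (f s) (μ r)) :
    Integrable (fun u : n → α => (Matrix.of fun r s => f s (u r)).det) (Measure.pi μ) ∧
      (Matrix.of fun r s => ∫ u, f s u ∂μ r).det =
        ∫ u : n → α, (Matrix.of fun r s => f s (u r)).det ∂Measure.pi μ := by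
  have hdet (A : Matrix n n ℝ) :
      A.det = ∑ σ : Equiv.Perm n, ((Equiv.Perm.sign σ : ℤ) : ℝ) * ∏ r, A r (σ r) := by
    rw [← Matrix.det_transpose, Matrix.det_apply']
    rfl
  have hint (σ : Equiv.Perm n) : Integrable (fun u : n → α =>
      ((Equiv.Perm.sign σ : ℤ) : ℝ) * ∏ r, f (σ r) (u r)) (Measure.pi μ) :=
    (Integrable.fintype_prod_dep (f := fun r => f (σ r)) fun r => hf r (σ r)).const_mul _
  simp only [hdet, Matrix.of_apply]
  refine ⟨integrable_finsetSum _ fun σ _ => hint σ, ?_⟩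
  rw [integral_finsetSum _ fun σ _ => hint σ]
  refine Finset.sum_congr rfl fun σ _ => ?_
  rw [integral_const_mul, integral_fintype_prod_eq_prod fun r => f (σ r)]

/-- An integrable function that is almost everywhere positive for a nonzero measure has positive
integral. -/
theorem integral_pos_of_ae_pos {α : Type*} [MeasurableSpace α] {μ : Measure α} {f : α → ℝ}
    (hμ : μ ≠ 0) (hf : Integrable f μ) (hpos : ∀ᵐ a ∂μ, 0 < f a) : 0 < ∫ a, f a ∂μ := by
  rw [integral_pos_iff_support_of_nonneg_ae (hpos.mono fun _ h => h.le) hf]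
  have hsupp : μ (Function.support f)ᶜ = 0 := mem_ae_iff.1 (hpos.mono fun _ h => h.ne')
  refine pos_iff_ne_zero.2 fun h => hμ ?_
  rw [← Measure.measure_univ_eq_zero, ← Set.union_compl_self (Function.support f)]
  exact measure_union_null h hsupp

theorem intervalIntegrable_abs_sub_rpow {p : ℝ} (hp : -1 < p) (e c d : ℝ) :
    IntervalIntegrable (fun u => |u - e| ^ p) volume c d := by
  have h := (intervalIntegral.intervalIntegrable_cpow' (a := c - e) (b := d - e) (r := (p : ℂ))
    (by simpa using hp)).norm
  simp only [Complex.norm_cpow_real, Complex.norm_real, Real.norm_eq_abs] at h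
  simpa using h.comp_sub_right e

theorem intervalIntegrable_prod_abs_sub_rpow {ι : Type*} [DecidableEq ι] {p : ℝ} (hp : -1 < p)
    (S : Finset ι) (x : ι → ℝ) {i : ι} (hi : i ∈ S) {c d : ℝ}
    (hne : ∀ j ∈ S, j ≠ i → x j ∉ Set.uIcc c d) :
    IntervalIntegrable (fun u => ∏ j ∈ S, |u - x j| ^ p) volume c d := by
  simp only [← Finset.mul_prod_erase S _ hi]
  refine (intervalIntegrable_abs_sub_rpow hp (x i) c d).mul_continuousOn ?_
  refine continuousOn_finsetProd _ fun j hj => ?_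
  refine ContinuousOn.rpow_const (by fun_prop) fun u hu => Or.inl ?_
  rw [abs_ne_zero, sub_ne_zero]
  rintro rfl
  exact hne j (Finset.mem_of_mem_erase hj) (Finset.ne_of_mem_erase hj) hu

/-- A product of powers of distances to points, with exponent greater than `-1`, is integrable on an
interval whose closure contains none of these points except its ends. -/
theorem integrableOn_prod_abs_sub_rpow {ι : Type*} [DecidableEq ι] {p : ℝ} (hp : -1 < p)
    (S : Finset ι) (x : ι → ℝ) {i k : ι} (hi : i ∈ S) (hk : k ∈ S) (hik : x i < x k)
    (hne : ∀ j ∈ S, j ≠ i → j ≠ k → x j ∉ Set.Icc (x i) (x k)) (q : ℝ → ℝ) (hq : Continuous q) :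
    IntegrableOn (fun u => q u * ∏ j ∈ S, |u - x j| ^ p) (Set.Ioo (x i) (x k)) := by
  obtain ⟨m, him, hmk⟩ := exists_between hik
  have h : IntervalIntegrable (fun u => ∏ j ∈ S, |u - x j| ^ p) volume (x i) (x k) := by
    refine (intervalIntegrable_prod_abs_sub_rpow hp S x hi (d := m) ?_).trans
      (intervalIntegrable_prod_abs_sub_rpow hp S x hk ?_)
    · intro j hj hji hmem
      rw [Set.uIcc_of_le him.le] at hmem
      by_cases hjk : j = k
      · subst hjk
        exact hmem.2.not_gt hmk
      · exact hne j hj hji hjk ⟨hmem.1, hmem.2.trans hmk.le⟩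
    · intro j hj hjk hmem
      rw [Set.uIcc_of_le hmk.le] at hmem
      by_cases hji : j = i
      · subst hji
        exact hmem.1.not_gt him
      · exact hne j hj hji hjk ⟨him.le.trans hmem.1, hmem.2⟩
  exact (intervalIntegrable_iff_integrableOn_Ioo_of_le hik.le).1
    (h.continuousOn_mul hq.continuousOn)

/-- **Positivity of the determinant of the period matrix `P`** (equations (4.13), (4.20)):
`P_{r,s} = ∫_{x_{2r−1}}^{x_{2r}} u^{s−1} ∏_{j=1}^{2N} |u−x_j|^{−1/2} du` has `det P > 0`. -/
theorem period_matrix_det_pos (N : ℕ) (hN : 1 ≤ N) (x : ℕ → ℝ)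
    (hx : ∀ i k : ℕ, 1 ≤ i → i < k → k ≤ 2 * N → x i < x k) :
    0 < (Matrix.of fun r s : Fin N =>
        ∫ u in Set.Ioo (x (2 * (r : ℕ) + 1)) (x (2 * (r : ℕ) + 2)),
          u ^ (s : ℕ) * ∏ i ∈ Finset.Icc 1 (2 * N), |u - x i| ^ (-(2 : ℝ)⁻¹)).det := by
  have hxle : ∀ i k : ℕ, 1 ≤ i → i ≤ k → k ≤ 2 * N → x i ≤ x k := fun i k hi hik hk =>
    hik.eq_or_lt.elim (fun h => h ▸ le_rfl) fun h => (hx i k hi h hk).le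
  set w : ℝ → ℝ := fun u => ∏ i ∈ Finset.Icc 1 (2 * N), |u - x i| ^ (-(2 : ℝ)⁻¹)
  set I : Fin N → Set ℝ := fun r => Set.Ioo (x (2 * (r : ℕ) + 1)) (x (2 * (r : ℕ) + 2))
  have hlt (r : Fin N) : x (2 * (r : ℕ) + 1) < x (2 * (r : ℕ) + 2) :=
    hx _ _ (by omega) (by omega) (by omega)
  have hint (r s : Fin N) : Integrable (fun u => u ^ (s : ℕ) * w u) (volume.restrict (I r)) := by
    refine integrableOn_prod_abs_sub_rpow (by norm_num) _ x (Finset.mem_Icc.2 (by omega))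
      (Finset.mem_Icc.2 (by omega)) (hlt r) (fun j hj hji hjk hmem => ?_) _ (by fun_prop)
    rw [Finset.mem_Icc] at hj
    rcases lt_or_ge j (2 * (r : ℕ) + 1) with h | h
    · exact hmem.1.not_gt (hx _ _ hj.1 h (by omega))
    · exact hmem.2.not_gt (hx _ _ (by omega) (by omega) hj.2)
  have hw (r : Fin N) {u : ℝ} (hu : u ∈ I r) : 0 < w u := by
    refine Finset.prod_pos fun j hj => Real.rpow_pos_of_pos (abs_pos.2 (sub_ne_zero.2 ?_)) _
    rw [Finset.mem_Icc] at hj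
    rcases le_or_gt j (2 * (r : ℕ) + 1) with h | h
    · exact ((hxle _ _ hj.1 h (by omega)).trans_lt hu.1).ne'
    · exact (hu.2.trans_le (hxle _ _ (by omega) h hj.2)).ne
  obtain ⟨hdet_int, hdet_eq⟩ := det_integral_eq_integral_det (fun r => volume.restrict (I r))
    (fun (s : Fin N) u => u ^ (s : ℕ) * w u) hint
  rw [hdet_eq]
  refine integral_pos_of_ae_pos ?_ hdet_int ?_
  · rw [Ne, ← Measure.measure_univ_eq_zero, Measure.pi_univ, Finset.prod_eq_zero_iff]
    rintro ⟨r, -, hr⟩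
    simp [I, (hlt r).not_ge] at hr
  · have hmem : ∀ᵐ u ∂Measure.pi fun r => volume.restrict (I r), ∀ r, u r ∈ I r :=
      Filter.eventually_all.2 fun r =>
        Measure.tendsto_eval_ae_ae.eventually (ae_restrict_mem measurableSet_Ioo)
    filter_upwards [hmem] with u hu
    have hfac : (Matrix.of fun r s : Fin N => u r ^ (s : ℕ) * w (u r)).det =
        (∏ r, w (u r)) * (Matrix.vandermonde u).det := by
      rw [← Matrix.det_mul_column]
      congr 1
      ext r s
      simp [Matrix.vandermonde_apply, mul_comm]
    rw [hfac, Matrix.det_vandermonde]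
    refine mul_pos (Finset.prod_pos fun r _ => hw r (hu r)) <|
      Finset.prod_pos fun r _ => Finset.prod_pos fun s hs => sub_pos.2 ?_
    have hrs : r < s := Finset.mem_Ioi.1 hs
    exact (hu r).2.trans ((hx _ _ (by omega) (by omega) (by omega)).trans (hu s).1)
end

section
/- Let N ≥ 3 and let x_1 < x_2 < ⋯ < x_{2N} be real numbers. Define the (N−2)×(N−2) real matrix R by R_{r,s} = ∫_{x_{2r+1}}^{x_{2r+2}} u^{s−1} · ∏_{j=1}^{2N} |u − x_j|^{−1/2} du for r, s ∈ {1,…,N−2} (each entry is a finite, absolutely convergent integral). Then det R > 0; in particular, R is invertible. -/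
open MeasureTheory

/-- **Andréief's identity**, in the form with one measure per row: the determinant of a matrix of
integrals is the integral of the determinant over the product measure. -/
theorem integrable_det_and_det_integral {n : Type*} [Fintype n] [DecidableEq n] {E : Type*}
    [MeasurableSpace E] (μ : n → Measure E) [∀ i, SigmaFinite (μ i)] (f : n → E → ℝ)
    (hf : ∀ r s, Integrable (f s) (μ r)) :
    Integrable (fun u : n → E => (Matrix.of fun r s => f s (u r)).det) (Measure.pi μ) ∧
      (Matrix.of fun r s => ∫ u, f s u ∂μ r).det =
        ∫ u : n → E, (Matrix.of fun r s => f s (u r)).det ∂Measure.pi μ := by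
  have key : ∀ M : Matrix n n ℝ, M.det =
      ∑ σ : Equiv.Perm n, ((Equiv.Perm.sign σ : ℤ) : ℝ) * ∏ i, M i (σ i) := fun M => by
    rw [← Matrix.det_transpose, Matrix.det_apply']
    rfl
  have hint : ∀ σ : Equiv.Perm n, Integrable
      (fun u : n → E => ((Equiv.Perm.sign σ : ℤ) : ℝ) * ∏ i, f (σ i) (u i)) (Measure.pi μ) :=
    fun σ => (Integrable.fintype_prod (f := fun i => f (σ i)) fun i => hf i (σ i)).const_mul _
  simp only [key, Matrix.of_apply]
  refine ⟨integrable_finsetSum _ fun σ _ => hint σ, ?_⟩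
  rw [integral_finsetSum _ fun σ _ => hint σ]
  refine Finset.sum_congr rfl fun σ _ => ?_
  rw [integral_const_mul, integral_fintype_prod_eq_prod (f := fun i => f (σ i))]

theorem locallyIntegrable_abs_sub_rpow {r : ℝ} (hr : -1 < r) (c : ℝ) :
    LocallyIntegrable (fun u : ℝ => |u - c| ^ r) := by
  have h0 : ∀ a b : ℝ, IntervalIntegrable (fun u : ℝ => |u| ^ r) volume a b := fun a b => by
    refine intervalIntegrable_of_even (fun u => by simp) fun t ht => ?_
    refine (intervalIntegral.intervalIntegrable_rpow' hr).congr fun u hu => ?_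
    rw [Set.uIoc_of_le ht.le] at hu
    simp only [abs_of_pos hu.1]
  intro p
  refine ⟨Set.Ioc (p - 1) (p + 1), Ioc_mem_nhds (by linarith) (by linarith), ?_⟩
  rw [← intervalIntegrable_iff_integrableOn_Ioc_of_le (by linarith)]
  simpa using (h0 (p - 1 - c) (p + 1 - c)).comp_sub_right c

/-- Integrable power singularities at finitely many distinct points are locally integrable. -/
theorem locallyIntegrable_mul_prod_abs_sub_rpow {ι : Type*} {r : ℝ} (hr : -1 < r)
    (S : Finset ι) (x : ι → ℝ) (hx : Set.InjOn x S) {g : ℝ → ℝ} (hg : Continuous g) :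
    LocallyIntegrable (fun u : ℝ => g u * ∏ i ∈ S, |u - x i| ^ r) := by
  classical
  have hcont : ∀ (p : ℝ) (T : Finset ι), (∀ i ∈ T, x i ≠ p) →
      ContinuousAt (fun u : ℝ => g u * ∏ i ∈ T, |u - x i| ^ r) p := fun p T hT =>
    hg.continuousAt.mul <| tendsto_finsetProd _ fun i hi =>
      ContinuousAt.rpow_const (by fun_prop) (.inl <| abs_ne_zero.2 <| sub_ne_zero.2 (hT i hi).symm)
  have hmeas : Measurable (fun u : ℝ => g u * ∏ i ∈ S, |u - x i| ^ r) := by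
    have := hg.measurable
    fun_prop
  intro p
  have hsm := hmeas.aestronglyMeasurable.stronglyMeasurableAtFilter (μ := volume) (l := nhds p)
  by_cases hp : ∃ k ∈ S, x k = p
  · obtain ⟨k, hk, rfl⟩ := hp
    refine Asymptotics.IsBigO.integrableAtFilter (g := fun u => |u - x k| ^ r) ?_ hsm
      (locallyIntegrable_abs_sub_rpow hr (x k) (x k))
    have hO := (hcont (x k) (S.erase k) fun i hi h =>
      (Finset.mem_erase.1 hi).1 (hx (Finset.mem_erase.1 hi).2 hk h)).isBigO_one ℝ
    refine (hO.mul (Asymptotics.isBigO_refl (fun u => |u - x k| ^ r) _)).congr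
      (fun u => ?_) fun u => one_mul _
    rw [mul_assoc, Finset.prod_erase_mul _ _ hk]
  · push Not at hp
    refine Asymptotics.IsBigO.integrableAtFilter (g := fun _ => (1 : ℝ))
      ((hcont p S hp).isBigO_one ℝ) hsm ((locallyIntegrable_const (1 : ℝ)) p)

/-- Moment matrices of a positive weight over ordered disjoint intervals have positive
determinant. -/
theorem det_setIntegral_pow_mul_pos {n : ℕ} (a b : Fin n → ℝ) (w : ℝ → ℝ)
    (hab : ∀ r, a r < b r) (hba : ∀ r s, r < s → b r ≤ a s)
    (hw : ∀ r, ∀ u ∈ Set.Ioo (a r) (b r), 0 < w u)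
    (hint : ∀ r s : Fin n, IntegrableOn (fun u => u ^ (s : ℕ) * w u) (Set.Ioo (a r) (b r))) :
    0 < (Matrix.of fun r s : Fin n =>
      ∫ u in Set.Ioo (a r) (b r), u ^ (s : ℕ) * w u).det := by
  obtain ⟨hI, hdet⟩ := integrable_det_and_det_integral
    (fun r => volume.restrict (Set.Ioo (a r) (b r))) (fun (s : Fin n) u => u ^ (s : ℕ) * w u) hint
  have hpos : ∀ u ∈ Set.univ.pi fun r => Set.Ioo (a r) (b r),
      0 < (Matrix.of fun r s : Fin n => u r ^ (s : ℕ) * w (u r)).det := fun u hu => by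
    have h : (Matrix.of fun r s : Fin n => u r ^ (s : ℕ) * w (u r)) =
        Matrix.of fun r s => w (u r) * Matrix.vandermonde u r s := by
      ext r s
      simp [Matrix.vandermonde_apply, mul_comm]
    rw [h, Matrix.det_mul_column, Matrix.det_vandermonde]
    refine mul_pos (Finset.prod_pos fun r _ => hw r _ (hu r trivial)) <|
      Finset.prod_pos fun r _ => Finset.prod_pos fun s hs => sub_pos.2 ?_
    exact (hu r trivial).2.trans_le (hba r s (Finset.mem_Ioi.1 hs)) |>.trans (hu s trivial).1
  rw [hdet]
  rw [← Measure.restrict_pi_pi] at hI ⊢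
  have hms : MeasurableSet (Set.univ.pi fun r => Set.Ioo (a r) (b r)) :=
    MeasurableSet.univ_pi fun r => measurableSet_Ioo
  rw [setIntegral_pos_iff_support_of_nonneg_ae
    (ae_restrict_of_forall_mem hms fun u hu => (hpos u hu).le) hI,
    Set.inter_eq_right.2 fun u hu => Function.mem_support.2 (hpos u hu).ne', Measure.pi_pi]
  exact pos_iff_ne_zero.2 <| Finset.prod_ne_zero_iff.2 fun r _ => by simpa using hab r

/-- **Positivity of the determinant of the matrix `R`** (equation (4.5)):
`R_{r,s} = ∫_{x_{2r+1}}^{x_{2r+2}} u^{s−1} ∏_{j=1}^{2N} |u−x_j|^{−1/2} du`, for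
`r, s ∈ {1,…,N−2}`, has `det R > 0`. -/
theorem schwarz_christoffel_matrix_det_pos (N : ℕ) (hN : 3 ≤ N) (x : ℕ → ℝ)
    (hx : ∀ i k : ℕ, 1 ≤ i → i < k → k ≤ 2 * N → x i < x k) :
    0 < (Matrix.of fun r s : Fin (N - 2) =>
        ∫ u in Set.Ioo (x (2 * (r : ℕ) + 3)) (x (2 * (r : ℕ) + 4)),
          u ^ (s : ℕ) * ∏ i ∈ Finset.Icc 1 (2 * N), |u - x i| ^ (-(2 : ℝ)⁻¹)).det := by
  have hinj : Set.InjOn x (Finset.Icc 1 (2 * N)) :=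
    StrictMonoOn.injOn fun i hi k hk hik =>
      hx i k (Finset.mem_Icc.1 hi).1 hik (Finset.mem_Icc.1 hk).2
  have hle : ∀ i k : ℕ, 1 ≤ i → i ≤ k → k ≤ 2 * N → x i ≤ x k := fun i k hi hik hk =>
    hik.eq_or_lt.elim (fun h => h ▸ le_rfl) fun h => (hx i k hi h hk).le
  refine det_setIntegral_pow_mul_pos (fun r => x (2 * (r : ℕ) + 3)) (fun r => x (2 * (r : ℕ) + 4))
    (fun u => ∏ i ∈ Finset.Icc 1 (2 * N), |u - x i| ^ (-(2 : ℝ)⁻¹))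
    (fun r => hx _ _ (by lia) (by lia) (by lia))
    (fun r s hrs => hle _ _ (by lia) (by lia) (by lia)) (fun r u hu => ?_) fun r s => ?_
  · refine Finset.prod_pos fun i hi => Real.rpow_pos_of_pos (abs_pos.2 (sub_ne_zero.2 ?_)) _
    obtain ⟨hi1, hi2⟩ := Finset.mem_Icc.1 hi
    rcases le_or_gt i (2 * (r : ℕ) + 3) with h | h
    · exact ((hle _ _ hi1 h (by lia)).trans_lt hu.1).ne'
    · exact (hu.2.trans_le (hle _ _ (by lia) h hi2)).ne
  · exact ((locallyIntegrable_mul_prod_abs_sub_rpow (by norm_num) _ x hinj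
      (continuous_pow (s : ℕ))).integrableOn_isCompact isCompact_Icc).mono_set
      Set.Ioo_subset_Icc_self
end

section
/- Let N ≥ 2, let α, β ∈ LP_N with M_{α,β} = 1, and let j ∈ {1,…,2N−1} with {j,j+1} ∈ α. Then {j,j+1} ∉ β, and the reduced patterns satisfy M_{α/{j,j+1}, ℘_j(β)/{j,j+1}} = 1 in LP_{N−1}. -/
open MeasureTheory

/-- A planar link pattern of size `N`: a noncrossing perfect matching of `{1,…,2N}`,
with the links `{a r, b r}` satisfying `a r < b r` and `a` strictly increasing. -/
structure LinkPattern (N : ℕ) where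
  a : Fin N → ℕ
  b : Fin N → ℕ
  a_lt_b : ∀ r, a r < b r
  a_mono : StrictMono a
  inj : Function.Injective (fun p : Fin N × Bool => if p.2 then b p.1 else a p.1)
  cover : ∀ k : ℕ, (∃ p : Fin N × Bool, (if p.2 then b p.1 else a p.1) = k) ↔ (1 ≤ k ∧ k ≤ 2 * N)
  noncross : ∀ r s : Fin N, ¬ (a r < a s ∧ a s < b r ∧ b r < b s)

/-- The (unordered) link relation of a link pattern. -/
def LinkPattern.Linked {N : ℕ} (β : LinkPattern N) (p q : ℕ) : Prop :=
  ∃ r, (β.a r = p ∧ β.b r = q) ∨ (β.a r = q ∧ β.b r = p)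

/-- The positive real integral `ρ_{k_1,…,k_N}(x)`. -/
noncomputable def rho (N : ℕ) (k : Fin N → ℕ) (x : ℕ → ℝ) : ℝ :=
  (∏ p ∈ (Finset.Icc 1 (2 * N) ×ˢ Finset.Icc 1 (2 * N)).filter fun p => p.1 < p.2,
      (x p.2 - x p.1) ^ ((4 : ℝ)⁻¹)) *
  ∫ u : Fin N → ℝ in Set.univ.pi fun r => Set.Ioo (x (k r)) (x (k r + 1)),
    (∏ p ∈ (Finset.univ ×ˢ Finset.univ : Finset (Fin N × Fin N)).filter fun p => p.1 < p.2,
        (u p.2 - u p.1)) *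
      ∏ r, ∏ i ∈ Finset.Icc 1 (2 * N), |u r - x i| ^ (-(2 : ℝ)⁻¹)

/-- The coefficient `c_β(k_1,…,k_N)`. -/
noncomputable def linkCoeff (N : ℕ) (β : LinkPattern N) (k : Fin N → ℕ) : ℂ :=
  Complex.I ^ ((∑ r, (k r : ℤ)) - ∑ r, (β.a r : ℤ)) *
    ∑ σ : Equiv.Perm (Fin N),
      ((Equiv.Perm.sign σ : ℤ) : ℂ) *
        ∏ r, if β.a r ≤ k (σ r) ∧ k (σ r) < β.b r then (1 : ℂ) else 0

/-- The Coulomb gas integral `F_β(x)`. -/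
noncomputable def coulomb (N : ℕ) (β : LinkPattern N) (x : ℕ → ℝ) : ℂ :=
  ∑ k ∈ (Fintype.piFinset fun _ : Fin N => Finset.Icc 1 (2 * N - 1)).filter
      fun k => ∀ r s : Fin N, r < s → k r < k s,
    linkCoeff N β k * (rho N k x : ℂ)

/-- Membership in the open chamber `𝔛_{2N}` (only coordinates `1,…,2N` are relevant). -/
def IsChamber (N : ℕ) (x : ℕ → ℝ) : Prop :=
  ∀ i k : ℕ, 1 ≤ i → i < k → k ≤ 2 * N → x i < x k

/-- The relabeling map `{1,…,2N}∖{j,j+1} → {1,…,2N−2}`: `k ↦ k` for `k < j`, `k ↦ k−2` for `k > j+1`. -/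
def relabelIdx (j k : ℕ) : ℕ := if k < j then k else k - 2

/-- `γ ∈ LP_{N−1}` is the pattern `β/{j,j+1}` obtained from `β ∈ LP_N` by deleting the link
`{j,j+1}` and relabeling the remaining indices in increasing order. -/
def IsReduction (N : ℕ) (β : LinkPattern N) (j : ℕ) (γ : LinkPattern (N - 1)) : Prop :=
  ∀ p q : ℕ, γ.Linked p q ↔
    ∃ p' q', β.Linked p' q' ∧ p' ≠ j ∧ p' ≠ j + 1 ∧ q' ≠ j ∧ q' ≠ j + 1 ∧
      p = relabelIdx j p' ∧ q = relabelIdx j q'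

/-- `δ ∈ LP_{N−1}` is the pattern `℘_j(β)/{j,j+1}` obtained from `β ∈ LP_N` (with `{j,j+1} ∉ β`,
partners `ℓ₁` of `j` and `ℓ₂` of `j+1`) by removing the links `{j,ℓ₁}`, `{j+1,ℓ₂}`, adding the
link `{ℓ₁,ℓ₂}`, removing the link `{j,j+1}` and relabeling the remaining indices. -/
def IsTieReduction (N : ℕ) (β : LinkPattern N) (j : ℕ) (δ : LinkPattern (N - 1)) : Prop :=
  ∃ l1 l2 : ℕ, β.Linked j l1 ∧ β.Linked (j + 1) l2 ∧
    ∀ p q : ℕ, δ.Linked p q ↔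
      ((∃ p' q', β.Linked p' q' ∧ p' ≠ j ∧ p' ≠ j + 1 ∧ q' ≠ j ∧ q' ≠ j + 1 ∧
          p = relabelIdx j p' ∧ q = relabelIdx j q') ∨
        (p = relabelIdx j l1 ∧ q = relabelIdx j l2) ∨
        (p = relabelIdx j l2 ∧ q = relabelIdx j l1))

/-- The meander matrix entry `M_{α,β}` equals `1`, i.e. the graph on `{1,…,2N}` with edge set
`α ∪ β` is connected. -/
def MeanderOne (N : ℕ) (α β : LinkPattern N) : Prop :=
  ∀ p q : ℕ, 1 ≤ p → p ≤ 2 * N → 1 ≤ q → q ≤ 2 * N →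
    Relation.ReflTransGen (fun u v => α.Linked u v ∨ β.Linked u v) p q

theorem LinkPattern.Linked.symm {N : ℕ} {β : LinkPattern N} {p q : ℕ} (h : β.Linked p q) :
    β.Linked q p :=
  h.imp fun _ => Or.symm

theorem LinkPattern.Linked.ne {N : ℕ} {β : LinkPattern N} {p q : ℕ} (h : β.Linked p q) :
    p ≠ q := by
  obtain ⟨r, h⟩ := h
  have := β.a_lt_b r
  omega

/-- The partner of an index in a link pattern is unique. -/
theorem LinkPattern.Linked.unique {N : ℕ} {β : LinkPattern N} {p q q' : ℕ}
    (h : β.Linked p q) (h' : β.Linked p q') : q = q' := by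
  obtain ⟨r, h⟩ := h
  obtain ⟨s, h'⟩ := h'
  have haa := @β.inj (r, false) (s, false)
  have hab := @β.inj (r, false) (s, true)
  have hba := @β.inj (r, true) (s, false)
  have hbb := @β.inj (r, true) (s, true)
  simp only [Bool.false_eq_true, if_false, if_true, Prod.mk.injEq] at haa hab hba hbb
  grind

/-- The relabeling map extended to `j` and `j + 1` by sending both of them to `c`. -/
def collapseIdx (j c k : ℕ) : ℕ := if k = j ∨ k = j + 1 then c else relabelIdx j k

theorem collapseIdx_of_ne {j c k : ℕ} (h : k ≠ j) (h' : k ≠ j + 1) :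
    collapseIdx j c k = relabelIdx j k :=
  if_neg (by tauto)

theorem collapseIdx_left (j c : ℕ) : collapseIdx j c j = c :=
  if_pos (Or.inl rfl)

theorem collapseIdx_right (j c : ℕ) : collapseIdx j c (j + 1) = c :=
  if_pos (Or.inr rfl)

theorem exists_collapseIdx_eq {N j p : ℕ} (hp : 1 ≤ p) (hpN : p ≤ 2 * (N - 1)) (c : ℕ) :
    ∃ p', 1 ≤ p' ∧ p' ≤ 2 * N ∧ collapseIdx j c p' = p := by
  by_cases h : p < j
  · exact ⟨p, hp, by omega, by unfold collapseIdx relabelIdx; split_ifs <;> omega⟩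
  · exact ⟨p + 2, by omega, by omega, by unfold collapseIdx relabelIdx; split_ifs <;> omega⟩

theorem MeanderOne.not_linked {N : ℕ} (hN : 2 ≤ N) {α β : LinkPattern N}
    (hM : MeanderOne N α β) {j : ℕ} (hj1 : 1 ≤ j) (hj2 : j ≤ 2 * N - 1)
    (hlink : α.Linked j (j + 1)) : ¬ β.Linked j (j + 1) := by
  intro hβ
  have closed : ∀ q, Relation.ReflTransGen (fun u v => α.Linked u v ∨ β.Linked u v) j q →
      q = j ∨ q = j + 1 := by
    intro q hq
    induction hq with
    | refl => exact Or.inl rfl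
    | tail _ h ih =>
      rcases ih with rfl | rfl <;> rcases h with h | h
      · exact Or.inr (h.unique hlink)
      · exact Or.inr (h.unique hβ)
      · exact Or.inl (h.unique hlink.symm)
      · exact Or.inl (h.unique hβ.symm)
  have h1 := closed 1 (hM j 1 hj1 (by omega) le_rfl (by omega))
  have h4 := closed 4 (hM j 4 hj1 (by omega) (by omega) (by omega))
  omega

theorem IsReduction.collapseIdx_reflTransGen {N : ℕ} {α : LinkPattern N} {j : ℕ}
    (hlink : α.Linked j (j + 1)) {γ : LinkPattern (N - 1)} (hγ : IsReduction N α j γ) (c : ℕ)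
    {u v : ℕ} (h : α.Linked u v) :
    Relation.ReflTransGen γ.Linked (collapseIdx j c u) (collapseIdx j c v) := by
  by_cases hu : u = j
  · subst hu
    rw [h.unique hlink, collapseIdx_left, collapseIdx_right]
  by_cases hu' : u = j + 1
  · subst hu'
    rw [h.unique hlink.symm, collapseIdx_left, collapseIdx_right]
  have hv : v ≠ j := by
    rintro rfl
    exact hu' (h.symm.unique hlink)
  have hv' : v ≠ j + 1 := by
    rintro rfl
    exact hu (h.symm.unique hlink.symm)
  rw [collapseIdx_of_ne hu hu', collapseIdx_of_ne hv hv']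
  exact .single ((hγ _ _).2 ⟨u, v, h, hu, hu', hv, hv', rfl, rfl⟩)

theorem IsTieReduction.exists_collapseIdx_reflTransGen {N : ℕ} {β : LinkPattern N} {j : ℕ}
    (hβ : ¬ β.Linked j (j + 1)) {δ : LinkPattern (N - 1)} (hδ : IsTieReduction N β j δ) :
    ∃ c, ∀ u v, β.Linked u v →
      Relation.ReflTransGen δ.Linked (collapseIdx j c u) (collapseIdx j c v) := by
  obtain ⟨l1, l2, h1, h2, hδ⟩ := hδ
  have h1j : l1 ≠ j := h1.ne.symm
  have h1j' : l1 ≠ j + 1 := by rintro rfl; exact hβ h1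
  have h2j : l2 ≠ j := by rintro rfl; exact hβ h2.symm
  have h2j' : l2 ≠ j + 1 := h2.ne.symm
  refine ⟨relabelIdx j l1, fun u v h => ?_⟩
  by_cases hu : u = j
  · subst hu
    rw [h.unique h1, collapseIdx_left, collapseIdx_of_ne h1j h1j']
  by_cases hu' : u = j + 1
  · subst hu'
    rw [h.unique h2, collapseIdx_right, collapseIdx_of_ne h2j h2j']
    exact .single ((hδ _ _).2 (Or.inr (Or.inl ⟨rfl, rfl⟩)))
  by_cases hv : v = j
  · subst hv
    rw [h.symm.unique h1, collapseIdx_left, collapseIdx_of_ne h1j h1j']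
  by_cases hv' : v = j + 1
  · subst hv'
    rw [h.symm.unique h2, collapseIdx_right, collapseIdx_of_ne h2j h2j']
    exact .single ((hδ _ _).2 (Or.inr (Or.inr ⟨rfl, rfl⟩)))
  rw [collapseIdx_of_ne hu hu', collapseIdx_of_ne hv hv']
  exact .single ((hδ _ _).2 (Or.inl ⟨u, v, h, hu, hu', hv, hv', rfl, rfl⟩))

/-- **Compatibility of the meander condition with link removal (Lemma 5.4).** If `M_{α,β} = 1`
and `{j,j+1} ∈ α`, then `{j,j+1} ∉ β` and `M_{α/{j,j+1}, ℘_j(β)/{j,j+1}} = 1`. -/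
theorem meander_one_reduction (N : ℕ) (hN : 2 ≤ N) (α β : LinkPattern N)
    (hM : MeanderOne N α β) (j : ℕ) (hj1 : 1 ≤ j) (hj2 : j ≤ 2 * N - 1)
    (hlink : α.Linked j (j + 1)) :
    ¬ β.Linked j (j + 1) ∧
    ∀ (γ δ : LinkPattern (N - 1)), IsReduction N α j γ → IsTieReduction N β j δ →
      MeanderOne (N - 1) γ δ := by
  have hβ := hM.not_linked hN hj1 hj2 hlink
  refine ⟨hβ, fun γ δ hγ hδ p q hp hpN hq hqN => ?_⟩
  obtain ⟨c, hc⟩ := hδ.exists_collapseIdx_reflTransGen hβ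
  obtain ⟨p', hp1, hp2, rfl⟩ := exists_collapseIdx_eq (j := j) hp hpN c
  obtain ⟨q', hq1, hq2, rfl⟩ := exists_collapseIdx_eq (j := j) hq hqN c
  refine Relation.ReflTransGen.lift' (collapseIdx j c) (fun u v h => ?_) p' q'
    (hM p' q' hp1 hp2 hq1 hq2)
  rcases h with h | h
  · exact Relation.ReflTransGen.mono (fun _ _ => Or.inl) _ _ (hγ.collapseIdx_reflTransGen hlink c h)
  · exact Relation.ReflTransGen.mono (fun _ _ => Or.inr) _ _ (hc u v h)
end

section
/- Let N ≥ 2 and j ∈ {1,…,2N−1}. For every α ∈ LP_N with {j,j+1} ∉ α, there exists β ∈ LP_N such that {j,j+1} ∈ β and M_{α,β} = 1. -/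
open MeasureTheory

/-- `f` restricts to a noncrossing fixed-point-free involution of `S`. -/
structure IsNoncrossingMatching (S : Finset ℕ) (f : ℕ → ℕ) : Prop where
  mem : ∀ x ∈ S, f x ∈ S
  invol : ∀ x ∈ S, f (f x) = x
  ne : ∀ x ∈ S, f x ≠ x
  noncross : ∀ x ∈ S, ∀ y ∈ S, ¬ (x < y ∧ y < f x ∧ f x < f y)

/-- The union of the matchings `f` and `g` is a connected graph on `S`. -/
def MatchingsConnected (S : Finset ℕ) (f g : ℕ → ℕ) : Prop :=
  ∀ x ∈ S, ∀ y ∈ S,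
    Relation.ReflTransGen (fun u v => u ∈ S ∧ (f u = v ∨ g u = v)) x y

/-- The matching obtained by joining the partners of `j` and `k` to each other. -/
def joinPartners (f : ℕ → ℕ) (j k : ℕ) (x : ℕ) : ℕ :=
  if x = f j then f k else if x = f k then f j else f x

/-- The matching obtained by adding the link `{j, k}`. -/
def addLink (g : ℕ → ℕ) (j k : ℕ) (x : ℕ) : ℕ :=
  if x = j then k else if x = k then j else g x

namespace IsNoncrossingMatching

variable {S : Finset ℕ} {f g : ℕ → ℕ} {j k : ℕ}

theorem joinPartners (hf : IsNoncrossingMatching S f) (hj : j ∈ S) (hk : k ∈ S) (hjk : j < k)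
    (hadj : ∀ x ∈ S, x ≤ j ∨ k ≤ x) (hne : f j ≠ k) :
    IsNoncrossingMatching ((S.erase j).erase k) (joinPartners f j k) := by
  obtain ⟨hm, hi, hn, hc⟩ := hf
  have haS := hm j hj
  have hcS := hm k hk
  have haj := hi j hj
  have hck := hi k hk
  have hnj := hn j hj
  have hnk := hn k hk
  have hkj : f k ≠ j := fun h => hne (by rw [← h, hck])
  have hac : f j ≠ f k := fun h => hjk.ne (by rw [← haj, h, hck])
  have key : ∀ x ∈ S, x ≠ j → x ≠ k → x ≠ f j → x ≠ f k →
      f x ∈ S ∧ f x ≠ j ∧ f x ≠ k ∧ f x ≠ f j ∧ f x ≠ f k := by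
    intro x hx h1 h2 h3 h4
    have := hi x hx
    refine ⟨hm x hx, ?_, ?_, ?_, ?_⟩ <;> intro h <;> rw [h] at this
    · exact h3 this.symm
    · exact h4 this.symm
    · rw [haj] at this; exact h1 this.symm
    · rw [hck] at this; exact h2 this.symm
  have hjoin : ∀ x, _root_.joinPartners f j k x =
      if x = f j then f k else if x = f k then f j else f x := fun _ => rfl
  refine ⟨?_, ?_, ?_, ?_⟩
  · intro x hx
    simp only [Finset.mem_erase] at hx ⊢
    grind
  · intro x hx
    simp only [Finset.mem_erase] at hx
    grind
  · intro x hx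
    simp only [Finset.mem_erase] at hx
    grind
  · -- a link disjoint from `{j, f j}` and `{k, f k}` does not separate `f j` from `f k`
    have sep : ∀ x ∈ S, x ≠ j → x ≠ k → x ≠ f j → x ≠ f k → x < f x →
        (x < f j ∧ f j < f x ↔ x < f k ∧ f k < f x) := by
      intro x hx h1 h2 h3 h4 hlt
      obtain ⟨k0, k1, k2, k3, k4⟩ := key x hx h1 h2 h3 h4
      have a1 := hadj x hx
      have a2 := hadj _ k0
      have c1 := hc x hx j hj
      have c2 := hc x hx _ haS
      have c3 := hc j hj x hx
      have c4 := hc _ haS x hx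
      have d1 := hc x hx k hk
      have d2 := hc x hx _ hcS
      have d3 := hc k hk x hx
      have d4 := hc _ hcS x hx
      rw [haj] at c2 c4
      rw [hck] at d2 d4
      omega
    intro x hx y hy
    simp only [Finset.mem_erase] at hx hy
    obtain ⟨hxk, hxj, hxS⟩ := hx
    obtain ⟨hyk, hyj, hyS⟩ := hy
    have hxy := hc x hxS y hyS
    have sx := sep x hxS hxj hxk
    have sy := sep y hyS hyj hyk
    have kx := key x hxS hxj hxk
    have ky := key y hyS hyj hyk
    rw [hjoin, hjoin]
    split_ifs <;> omega

theorem addLink (hg : IsNoncrossingMatching ((S.erase j).erase k) g) (hj : j ∈ S) (hk : k ∈ S)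
    (hjk : j < k) (hadj : ∀ x ∈ S, x ≤ j ∨ k ≤ x) :
    IsNoncrossingMatching S (addLink g j k) := by
  obtain ⟨hm, hi, hn, hc⟩ := hg
  simp only [Finset.mem_erase] at hm hi hn hc
  have hadd : ∀ x, _root_.addLink g j k x =
      if x = j then k else if x = k then j else g x := fun _ => rfl
  refine ⟨?_, ?_, ?_, ?_⟩
  · grind
  · grind
  · grind
  · intro x hx y hy
    have := hadj x hx
    have := hadj y hy
    have mx := hm x
    have my := hm y
    have := hc x
    rw [hadd, hadd]
    grind

/-- Connectedness lifts along the removal of the adjacent points `j` and `k`. -/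
theorem connected_addLink (hf : IsNoncrossingMatching S f) (hj : j ∈ S) (hk : k ∈ S)
    (hjk : j < k) (hne : f j ≠ k)
    (h : MatchingsConnected ((S.erase j).erase k) (_root_.joinPartners f j k) g) :
    MatchingsConnected S f (_root_.addLink g j k) := by
  set R : ℕ → ℕ → Prop := fun u v => u ∈ S ∧ (f u = v ∨ _root_.addLink g j k u = v) with hR
  have haj := hf.invol j hj
  have hck := hf.invol k hk
  have r1 : R j (f j) := ⟨hj, Or.inl rfl⟩
  have r2 : R (f j) j := ⟨hf.mem j hj, Or.inl haj⟩
  have r3 : R k (f k) := ⟨hk, Or.inl rfl⟩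
  have r4 : R (f k) k := ⟨hf.mem k hk, Or.inl hck⟩
  have r5 : R j k := ⟨hj, Or.inr (by simp [_root_.addLink])⟩
  have r6 : R k j := ⟨hk, Or.inr (by simp [_root_.addLink, hjk.ne'])⟩
  have step : ∀ u v, u ∈ (S.erase j).erase k ∧ (_root_.joinPartners f j k u = v ∨ g u = v) →
      Relation.ReflTransGen R u v := by
    rintro u v ⟨hu, huv⟩
    simp only [Finset.mem_erase] at hu
    obtain ⟨huk, huj, huS⟩ := hu
    rcases huv with huv | huv
    · unfold _root_.joinPartners at huv
      split_ifs at huv with h1 h2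
      · rw [h1, ← huv]
        exact ((Relation.ReflTransGen.single r2).tail r5).tail r3
      · rw [h2, ← huv]
        exact ((Relation.ReflTransGen.single r4).tail r6).tail r1
      · exact Relation.ReflTransGen.single ⟨huS, Or.inl huv⟩
    · exact Relation.ReflTransGen.single ⟨huS, Or.inr (by simp [_root_.addLink, huj, huk, huv])⟩
  have lift : ∀ x ∈ S, ∃ y ∈ (S.erase j).erase k,
      Relation.ReflTransGen R x y ∧ Relation.ReflTransGen R y x := by
    intro x hx
    by_cases hxj : x = j
    · subst hxj
      exact ⟨f x, by simp [hne, hf.ne x hx, hf.mem x hx], .single r1, .single r2⟩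
    by_cases hxk : x = k
    · subst hxk
      have hkj : f x ≠ j := fun h => hne (by rw [← h, hck])
      exact ⟨f x, by simp [hkj, hf.ne x hx, hf.mem x hx], .single r3, .single r4⟩
    · exact ⟨x, by simp [hxj, hxk, hx], .refl, .refl⟩
  intro x hx y hy
  obtain ⟨x', hx', h1, -⟩ := lift x hx
  obtain ⟨y', hy', -, h2⟩ := lift y hy
  refine h1.trans (Relation.ReflTransGen.trans ?_ h2)
  have hxy := h x' hx' y' hy'
  clear h1 h2
  induction hxy with
  | refl => exact .refl
  | tail _ hs ih =>
    refine (ih ?_).trans (step _ _ hs)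
    exact hs.1

/-- A nonempty matching is a single link or misses the link between some adjacent points. -/
theorem exists_adjacent (hf : IsNoncrossingMatching S f) (hS : S.Nonempty) :
    MatchingsConnected S f f ∨
      ∃ j ∈ S, ∃ k ∈ S, j < k ∧ (∀ x ∈ S, x ≤ j ∨ k ≤ x) ∧ f j ≠ k := by
  obtain ⟨x, hx, hxmin⟩ : ∃ x ∈ S, ∀ z ∈ S, x ≤ z :=
    ⟨S.min' hS, S.min'_mem hS, fun z hz => S.min'_le z hz⟩
  have hS1 : (S.erase x).Nonempty := ⟨f x, by simp [hf.ne x hx, hf.mem x hx]⟩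
  obtain ⟨y, hy, hymin⟩ : ∃ y ∈ S.erase x, ∀ z ∈ S.erase x, y ≤ z :=
    ⟨_, Finset.min'_mem _ hS1, fun z hz => Finset.min'_le _ z hz⟩
  simp only [Finset.mem_erase] at hy hymin
  have hxy : x < y := lt_of_le_of_ne (hxmin y hy.2) (Ne.symm hy.1)
  by_cases hfx : f x = y
  swap
  · exact Or.inr ⟨x, hx, y, hy.2, hxy, by grind, hfx⟩
  have hfy : f y = x := by rw [← hfx, hf.invol x hx]
  by_cases hS2 : ((S.erase x).erase y).Nonempty
  · obtain ⟨z, hz, hzmin⟩ : ∃ z ∈ (S.erase x).erase y, ∀ w ∈ (S.erase x).erase y, z ≤ w :=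
      ⟨_, Finset.min'_mem _ hS2, fun z hz => Finset.min'_le _ z hz⟩
    simp only [Finset.mem_erase] at hz hzmin
    have := hymin z hz.2
    exact Or.inr ⟨y, hy.2, z, hz.2.2, by omega, by grind, by omega⟩
  · left
    have hall : ∀ w ∈ S, w = x ∨ w = y := by
      intro w hw
      by_contra hcon
      push Not at hcon
      exact hS2 ⟨w, by simp [hcon, hw]⟩
    intro u hu v hv
    rcases hall u hu with rfl | rfl <;> rcases hall v hv with rfl | rfl
    · exact .refl
    · exact .single ⟨hu, Or.inl hfx⟩
    · exact .single ⟨hu, Or.inl hfy⟩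
    · exact .refl

theorem exists_connected (S : Finset ℕ) (f : ℕ → ℕ) (hf : IsNoncrossingMatching S f) (j k : ℕ)
    (hj : j ∈ S) (hk : k ∈ S) (hjk : j < k) (hadj : ∀ x ∈ S, x ≤ j ∨ k ≤ x) (hne : f j ≠ k) :
    ∃ g, IsNoncrossingMatching S g ∧ g j = k ∧ MatchingsConnected S f g := by
  induction S using Finset.strongInduction generalizing f j k with
  | H S ih =>
    have hf' := hf.joinPartners hj hk hjk hadj hne
    have hsub : (S.erase j).erase k ⊂ S :=
      (Finset.erase_subset _ _).trans_ssubset (Finset.erase_ssubset hj)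
    have hnon : ((S.erase j).erase k).Nonempty :=
      ⟨f j, by simp [hne, hf.ne j hj, hf.mem j hj]⟩
    obtain ⟨g, hg, hcon⟩ : ∃ g, IsNoncrossingMatching ((S.erase j).erase k) g ∧
        MatchingsConnected ((S.erase j).erase k) (_root_.joinPartners f j k) g := by
      rcases hf'.exists_adjacent hnon with h | ⟨p, hp, q, hq, hpq, hadj', hne'⟩
      · exact ⟨_, hf', h⟩
      · obtain ⟨g, hg, -, hcon⟩ := ih _ hsub _ hf' p q hp hq hpq hadj' hne'
        exact ⟨g, hg, hcon⟩
    exact ⟨_root_.addLink g j k, hg.addLink hj hk hjk hadj, by simp [_root_.addLink],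
      hf.connected_addLink hj hk hjk hne hcon⟩

theorem two_mul_card_openers (hf : IsNoncrossingMatching S f) :
    2 * (S.filter fun x => x < f x).card = S.card := by
  have h1 := Finset.card_filter_add_card_filter_not (s := S) (fun x => x < f x)
  have h2 : (S.filter fun x => x < f x).card = (S.filter fun x => ¬ x < f x).card := by
    refine Finset.card_bij' (fun x _ => f x) (fun x _ => f x) ?_ ?_ ?_ ?_ <;>
      intro x hx <;> simp only [Finset.mem_filter] at hx ⊢ <;>
      have := hf.mem x hx.1 <;> have := hf.invol x hx.1 <;> have := hf.ne x hx.1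
    · refine ⟨by assumption, by omega⟩
    · refine ⟨by assumption, by omega⟩
    · assumption
    · assumption
  omega

/-- Every noncrossing matching of `{1, …, 2N}` comes from a link pattern. -/
theorem exists_linkPattern {N : ℕ} (hg : IsNoncrossingMatching (Finset.Icc 1 (2 * N)) g) :
    ∃ β : LinkPattern N, ∀ x, 1 ≤ x → x ≤ 2 * N → β.Linked x (g x) := by
  set T := (Finset.Icc 1 (2 * N)).filter fun x => x < g x with hT
  have hcard : T.card = N := by
    have : 2 * T.card = _ := hg.two_mul_card_openers
    rw [Nat.card_Icc] at this
    omega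
  have hmem : ∀ r, T.orderEmbOfFin hcard r ∈ T := fun r => T.orderEmbOfFin_mem hcard r
  have hsurj : ∀ x ∈ T, ∃ r, T.orderEmbOfFin hcard r = x := by
    intro x hx
    have : x ∈ Set.range (T.orderEmbOfFin hcard) := by
      rw [Finset.range_orderEmbOfFin]; exact hx
    exact this
  have hS : ∀ r, T.orderEmbOfFin hcard r ∈ Finset.Icc 1 (2 * N) := fun r =>
    (Finset.mem_filter.1 (hmem r)).1
  have hlt : ∀ r, T.orderEmbOfFin hcard r < g (T.orderEmbOfFin hcard r) := fun r =>
    (Finset.mem_filter.1 (hmem r)).2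
  have hcov : ∀ x ∈ Finset.Icc 1 (2 * N), ∃ r,
      T.orderEmbOfFin hcard r = x ∨ (g (T.orderEmbOfFin hcard r) = x ∧
        T.orderEmbOfFin hcard r = g x) := by
    intro x hx
    by_cases h : x < g x
    · obtain ⟨r, hr⟩ := hsurj x (Finset.mem_filter.2 ⟨hx, h⟩)
      exact ⟨r, Or.inl hr⟩
    · have h1 := hg.ne x hx
      have h2 := hg.invol x hx
      obtain ⟨r, hr⟩ := hsurj (g x) (Finset.mem_filter.2 ⟨hg.mem x hx, by omega⟩)
      exact ⟨r, Or.inr ⟨by rw [hr, h2], hr⟩⟩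
  refine ⟨⟨fun r => T.orderEmbOfFin hcard r, fun r => g (T.orderEmbOfFin hcard r), hlt,
    (T.orderEmbOfFin hcard).strictMono, ?_, ?_, fun r s => hg.noncross _ (hS r) _ (hS s)⟩, ?_⟩
  · rintro ⟨r, c⟩ ⟨s, d⟩ h
    have ir := hg.invol _ (hS r)
    have is := hg.invol _ (hS s)
    have lr := hlt r
    have ls := hlt s
    have einj := (T.orderEmbOfFin hcard).injective
    cases c <;> cases d <;> simp at h
    · rw [h]
    · rw [h, is] at lr
      omega
    · rw [← h, ir] at ls
      omega
    · rw [h, is] at ir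
      rw [einj ir]
  · intro x
    constructor
    · rintro ⟨⟨r, c⟩, rfl⟩
      have h1 := Finset.mem_Icc.1 (hS r)
      have h2 := Finset.mem_Icc.1 (hg.mem _ (hS r))
      cases c
      · simpa using h1
      · simpa using h2
    · intro hx
      obtain ⟨r, h | h⟩ := hcov x (Finset.mem_Icc.2 hx)
      · exact ⟨(r, false), by simpa using h⟩
      · exact ⟨(r, true), by simpa using h.1⟩
  · intro x hx1 hx2
    obtain ⟨r, h | h⟩ := hcov x (Finset.mem_Icc.2 ⟨hx1, hx2⟩)
    · exact ⟨r, Or.inl ⟨h, by simp [h]⟩⟩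
    · exact ⟨r, Or.inr ⟨h.2, h.1⟩⟩

end IsNoncrossingMatching

namespace LinkPattern

variable {N : ℕ} (α : LinkPattern N)

theorem a_injective {r s : Fin N} (h : α.a r = α.a s) : r = s := α.a_mono.injective h

theorem b_injective {r s : Fin N} (h : α.b r = α.b s) : r = s :=
  congrArg Prod.fst (@α.inj (r, true) (s, true) (by simpa using h))

theorem a_ne_b (r s : Fin N) : α.a r ≠ α.b s := fun h => by
  simpa using @α.inj (r, false) (s, true) (by simpa using h)

theorem linked_symm {p q : ℕ} (h : α.Linked p q) : α.Linked q p := by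
  obtain ⟨r, h⟩ := h
  exact ⟨r, h.symm⟩

theorem linked_unique {p q q' : ℕ} (h : α.Linked p q) (h' : α.Linked p q') : q = q' := by
  obtain ⟨r, ⟨h1, h2⟩ | ⟨h1, h2⟩⟩ := h <;> obtain ⟨s, ⟨h3, h4⟩ | ⟨h3, h4⟩⟩ := h'
  · rw [← h2, ← h4, α.a_injective (h1.trans h3.symm)]
  · exact absurd (h1.trans h4.symm) (α.a_ne_b r s)
  · exact absurd (h3.trans h2.symm) (α.a_ne_b s r)
  · rw [← h1, ← h3, α.b_injective (h2.trans h4.symm)]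

theorem linked_range {p q : ℕ} (h : α.Linked p q) : 1 ≤ p ∧ p ≤ 2 * N := by
  obtain ⟨r, ⟨h1, -⟩ | ⟨-, h2⟩⟩ := h
  · exact (α.cover p).1 ⟨(r, false), by simpa using h1⟩
  · exact (α.cover p).1 ⟨(r, true), by simpa using h2⟩

theorem exists_linked {p : ℕ} (h1 : 1 ≤ p) (h2 : p ≤ 2 * N) : ∃ q, α.Linked p q := by
  obtain ⟨⟨r, c⟩, h⟩ := (α.cover p).2 ⟨h1, h2⟩
  cases c
  · exact ⟨α.b r, r, Or.inl ⟨by simpa using h, rfl⟩⟩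
  · exact ⟨α.a r, r, Or.inr ⟨rfl, by simpa using h⟩⟩

/-- Every link pattern is given by a noncrossing matching of `{1, …, 2N}`. -/
theorem exists_matching : ∃ f : ℕ → ℕ, IsNoncrossingMatching (Finset.Icc 1 (2 * N)) f ∧
    ∀ x ∈ Finset.Icc 1 (2 * N), α.Linked x (f x) := by
  have hex : ∀ x, ∃ y, x ∈ Finset.Icc 1 (2 * N) → α.Linked x y := by
    intro x
    by_cases hx : x ∈ Finset.Icc 1 (2 * N)
    · obtain ⟨y, hy⟩ := α.exists_linked (Finset.mem_Icc.1 hx).1 (Finset.mem_Icc.1 hx).2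
      exact ⟨y, fun _ => hy⟩
    · exact ⟨0, fun h => absurd h hx⟩
  choose f hf using hex
  have hm : ∀ x ∈ Finset.Icc 1 (2 * N), f x ∈ Finset.Icc 1 (2 * N) := fun x hx =>
    Finset.mem_Icc.2 (α.linked_range (α.linked_symm (hf x hx)))
  refine ⟨f, ⟨hm, ?_, ?_, ?_⟩, hf⟩
  · intro x hx
    exact α.linked_unique (hf _ (hm x hx)) (α.linked_symm (hf x hx))
  · intro x hx h
    obtain ⟨r, h1 | h1⟩ := hf x hx <;> have := α.a_lt_b r <;> omega
  · rintro x hx y hy ⟨h1, h2, h3⟩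
    obtain ⟨r, hr | hr⟩ := hf x hx <;> obtain ⟨s, hs | hs⟩ := hf y hy <;>
      have := α.a_lt_b r <;> have := α.a_lt_b s <;> have := α.noncross r s <;> omega

end LinkPattern

/-- **Lemma 5.5(1).** For every `α ∈ LP_N` with `{j,j+1} ∉ α` there is `β ∈ LP_N` with
`{j,j+1} ∈ β` and `M_{α,β} = 1`. -/
theorem exists_meander_one_with_link (N : ℕ) (hN : 2 ≤ N) (j : ℕ)
    (hj1 : 1 ≤ j) (hj2 : j ≤ 2 * N - 1)
    (α : LinkPattern N) (hα : ¬ α.Linked j (j + 1)) :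
    ∃ β : LinkPattern N, β.Linked j (j + 1) ∧ MeanderOne N α β := by
  obtain ⟨f, hf, hfα⟩ := α.exists_matching
  have hj : j ∈ Finset.Icc 1 (2 * N) := Finset.mem_Icc.2 ⟨hj1, by omega⟩
  have hk : j + 1 ∈ Finset.Icc 1 (2 * N) := Finset.mem_Icc.2 ⟨by omega, by omega⟩
  obtain ⟨g, hg, hgj, hcon⟩ := IsNoncrossingMatching.exists_connected _ f hf j (j + 1) hj hk
    (by omega) (fun x _ => by omega) (fun h => hα (h ▸ hfα j hj))
  obtain ⟨β, hβ⟩ := hg.exists_linkPattern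
  refine ⟨β, hgj ▸ hβ j hj1 (by omega), fun p q hp1 hp2 hq1 hq2 => ?_⟩
  refine Relation.ReflTransGen.mono ?_
    _ _ (hcon p (Finset.mem_Icc.2 ⟨hp1, hp2⟩) q (Finset.mem_Icc.2 ⟨hq1, hq2⟩))
  rintro u v ⟨hu, rfl | rfl⟩
  · exact Or.inl (hfα u hu)
  · exact Or.inr (hβ u (Finset.mem_Icc.1 hu).1 (Finset.mem_Icc.1 hu).2)
end

section
/- Let h : [0,1] → ℂ be continuous. Then lim_{λ → 0⁺} (log(1/λ))^{−1} · ∫_0^1 h(v) · (v(v+λ))^{−1/2} dv = h(0). -/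
open MeasureTheory

lemma hasDerivAt_two_mul_log_sqrt_add_sqrt {lam v : ℝ} (hlam : 0 < lam) (hv : 0 < v) :
    HasDerivAt (fun v => 2 * Real.log (√v + √(v + lam))) ((v * (v + lam)) ^ (-(2 : ℝ)⁻¹)) v := by
  have hvl : 0 < v + lam := by positivity
  have hsum : 0 < √v + √(v + lam) := by positivity
  have hderiv := (((Real.hasDerivAt_sqrt hv.ne').add
    (((hasDerivAt_id v).add_const lam).sqrt hvl.ne')).log hsum.ne').const_mul 2
  refine hderiv.congr_deriv ?_
  have hv' : 0 < √v := Real.sqrt_pos.2 hv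
  have hvl' : 0 < √(v + lam) := Real.sqrt_pos.2 hvl
  rw [Real.rpow_neg (by positivity), ← one_div (2 : ℝ), ← Real.sqrt_eq_rpow,
    Real.sqrt_mul hv.le]
  simp only [id, Pi.add_apply]
  field_simp
  ring

lemma integral_rpow_neg_half_mul_add {lam : ℝ} (hlam : 0 < lam) :
    ∫ v in Set.Ioo (0 : ℝ) 1, (v * (v + lam)) ^ (-(2 : ℝ)⁻¹) =
      2 * Real.log (1 + √(1 + lam)) + Real.log (1 / lam) := by
  have hcont : ContinuousOn (fun v => 2 * Real.log (√v + √(v + lam))) (Set.Icc 0 1) := by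
    refine continuousOn_const.mul (ContinuousOn.log (by fun_prop) fun v hv => ?_)
    have : 0 < √(v + lam) := Real.sqrt_pos.2 (by linarith [hv.1])
    positivity
  have hderiv (v : ℝ) (hv : v ∈ Set.Ioo (0 : ℝ) 1) :=
    hasDerivAt_two_mul_log_sqrt_add_sqrt hlam hv.1
  have hint := intervalIntegral.integrableOn_deriv_of_nonneg hcont hderiv fun v hv =>
    Real.rpow_nonneg (mul_nonneg hv.1.le (by linarith [hv.1])) _
  rw [← integral_Ioc_eq_integral_Ioo, ← intervalIntegral.integral_of_le zero_le_one,
    intervalIntegral.integral_eq_sub_of_hasDerivAt_of_le zero_le_one hcont hderiv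
      ((intervalIntegrable_iff_integrableOn_Ioc_of_le zero_le_one).2 hint)]
  simp only [Real.sqrt_one, Real.sqrt_zero, zero_add, Real.log_sqrt hlam.le, one_div,
    Real.log_inv]
  ring

lemma tendsto_log_one_div_nhdsGT_zero :
    Filter.Tendsto (fun lam : ℝ => Real.log (1 / lam)) (nhdsWithin 0 (Set.Ioi 0))
      Filter.atTop := by
  simp only [one_div]
  exact Real.tendsto_log_atTop.comp tendsto_inv_nhdsGT_zero

lemma tendsto_integral_normalized_kernel :
    Filter.Tendsto
      (fun lam : ℝ => ∫ v in Set.Ioo (0 : ℝ) 1,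
        (Real.log (1 / lam))⁻¹ * (v * (v + lam)) ^ (-(2 : ℝ)⁻¹))
      (nhdsWithin 0 (Set.Ioi 0)) (nhds 1) := by
  have hbdd : Filter.Tendsto (fun lam : ℝ => 2 * Real.log (1 + √(1 + lam)))
      (nhdsWithin 0 (Set.Ioi 0)) (nhds (2 * Real.log (1 + √(1 + 0)))) := by
    refine Filter.Tendsto.mono_left (ContinuousAt.tendsto ?_) nhdsWithin_le_nhds
    refine continuousAt_const.mul (ContinuousAt.log (by fun_prop) ?_)
    positivity
  have hlim := (tendsto_log_one_div_nhdsGT_zero.inv_tendsto_atTop.mul hbdd).add_const 1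
  rw [zero_mul, zero_add] at hlim
  refine hlim.congr' ?_
  filter_upwards [self_mem_nhdsWithin, tendsto_log_one_div_nhdsGT_zero.eventually_gt_atTop 0]
    with lam hlam hlog
  rw [integral_const_mul, integral_rpow_neg_half_mul_add hlam, mul_add,
    inv_mul_cancel₀ hlog.ne', Pi.inv_apply]

lemma tendstoUniformlyOn_normalized_kernel {u : Set ℝ} (hu : IsOpen u) (h0 : (0 : ℝ) ∈ u) :
    TendstoUniformlyOn
      (fun lam v : ℝ => (Real.log (1 / lam))⁻¹ * (v * (v + lam)) ^ (-(2 : ℝ)⁻¹)) 0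
      (nhdsWithin 0 (Set.Ioi 0)) (Set.Ioo 0 1 \ u) := by
  obtain ⟨δ, hδ, hball⟩ := Metric.isOpen_iff.1 hu 0 h0
  have hlim := tendsto_log_one_div_nhdsGT_zero.inv_tendsto_atTop.mul_const
    ((δ * δ) ^ (-(2 : ℝ)⁻¹))
  rw [zero_mul] at hlim
  refine Metric.tendstoUniformlyOn_iff.2 fun ε hε => ?_
  filter_upwards [self_mem_nhdsWithin, tendsto_log_one_div_nhdsGT_zero.eventually_gt_atTop 0,
    hlim.eventually_lt_const hε] with lam hlam hlog hlt v hv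
  have hlam' : 0 < lam := hlam
  have hv0 : 0 < v := hv.1.1
  have hδv : δ ≤ v := by
    by_contra! hlt'
    exact hv.2 (hball (by rwa [Metric.mem_ball, Real.dist_0_eq_abs, abs_of_pos hv0]))
  rw [Pi.zero_apply, dist_zero_left, Real.norm_of_nonneg (by positivity)]
  refine lt_of_le_of_lt ?_ hlt
  refine mul_le_mul_of_nonneg_left ?_ (inv_nonneg.2 hlog.le)
  refine Real.rpow_le_rpow_of_nonpos (by positivity) ?_ (by norm_num)
  gcongr
  linarith

/-- **The logarithmic singular limit**: for continuous `h : [0,1] → ℂ`,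
`(log(1/λ))⁻¹ ∫₀¹ h(v) (v(v+λ))^{−1/2} dv → h(0)` as `λ → 0⁺`. -/
theorem log_singular_integral_limit (h : ℝ → ℂ) (hcont : ContinuousOn h (Set.Icc 0 1)) :
    Filter.Tendsto
      (fun lam : ℝ => (((Real.log (1 / lam))⁻¹ : ℝ) : ℂ) *
        ∫ v in Set.Ioo (0 : ℝ) 1, h v * (((v * (v + lam)) ^ (-(2 : ℝ)⁻¹) : ℝ) : ℂ))
      (nhdsWithin 0 (Set.Ioi 0)) (nhds (h 0)) := by
  have hpeak := tendsto_setIntegral_peak_smul_of_integrableOn_of_tendsto (μ := volume) (g := h)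
    (φ := fun lam v : ℝ => (Real.log (1 / lam))⁻¹ * (v * (v + lam)) ^ (-(2 : ℝ)⁻¹))
    (l := nhdsWithin 0 (Set.Ioi 0)) (x₀ := 0) (a := h 0) (s := Set.Ioo 0 1)
    measurableSet_Ioo measurableSet_Ioo subset_rfl self_mem_nhdsWithin (by simp) ?_
    (fun u => tendstoUniformlyOn_normalized_kernel) tendsto_integral_normalized_kernel ?_
    (hcont.integrableOn_Icc.mono_set Set.Ioo_subset_Icc_self)
    ((hcont 0 (by simp)).mono_left (nhdsWithin_mono _ Set.Ioo_subset_Icc_self))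
  · refine hpeak.congr fun lam => ?_
    rw [← integral_const_mul]
    congr 1 with v
    rw [Complex.real_smul, Complex.ofReal_mul]
    ring
  · filter_upwards [self_mem_nhdsWithin,
      tendsto_log_one_div_nhdsGT_zero.eventually_gt_atTop 0] with lam hlam hlog v hv
    have hlam' : 0 < lam := hlam
    have hv0 : 0 < v := hv.1
    positivity
  · exact .of_forall fun lam => Measurable.aestronglyMeasurable (by fun_prop)
end
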